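/- Let λ₁ > ⋯ > λₙ > 0, a = λₙ/λ₁, and let x⁰ ∈ ℝⁿ, x⁰ ≠ 0, be a vector that is not an eigenvector of A = diag(λ). Let p⁰ = σ(x⁰) with σ(x)_i = λ_i² x_i² / Σ_j λ_j² x_j². If lim_{k→∞} T^{2k}(p⁰) = [1−s, 0, …, 0, s]ᵀ for some s ∈ [0,1], then the rate of convergence of exact line search gradient descent from x⁰ is exactly ρ*(x⁰,λ) = √(1 − (1−s+sa)^{−1}(1−s+s/a)^{−1}). -/

import Mathlib

open MeasureTheory Filter Finset Real Metric

noncomputable section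

/-- `qform lam k x = xᵀ Aᵏ x` for `A = diag lam`. -/
def qform {n : ℕ} (lam : Fin n → ℝ) (k : ℕ) (x : Fin n → ℝ) : ℝ :=
  ∑ i, lam i ^ k * x i ^ 2

/-- Exact line search gradient descent map for `f(x) = ½ xᵀAx`, `A = diag lam`;
`GD 0 = 0`. -/
def GD {n : ℕ} (lam : Fin n → ℝ) (x : Fin n → ℝ) : Fin n → ℝ :=
  if x = 0 then 0 else fun i => x i - qform lam 2 x / qform lam 3 x * (lam i * x i)

/-- One-step shrinking factor `ρ(x, λ)`, with the convention `ρ(0, λ) = 0`. -/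
def shrink {n : ℕ} (lam : Fin n → ℝ) (x : Fin n → ℝ) : ℝ :=
  if x = 0 then 0 else
    Real.sqrt (1 - (qform lam 2 x) ^ 2 / (qform lam 1 x * qform lam 3 x))

/-- Rate of convergence `ρ*(x⁰, λ)` of exact line search gradient descent from seed `x⁰`. -/
def rocGD {n : ℕ} (lam : Fin n → ℝ) (x0 : Fin n → ℝ) : ℝ :=
  Filter.limsup
    (fun k : ℕ => (∏ j ∈ Finset.range k, shrink lam ((GD lam)^[j] x0)) ^ ((k : ℝ)⁻¹))
    Filter.atTop

/-- `λ̄(p) = ∑ⱼ λⱼ pⱼ`. -/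
def lamMean {n : ℕ} (lam p : Fin n → ℝ) : ℝ := ∑ j, lam j * p j

/-- Akaike's map `T(p)ᵢ = pᵢ(λ̄(p) − λᵢ)² / ∑ⱼ pⱼ(λ̄(p) − λⱼ)²`. -/
def Tmap {n : ℕ} (lam : Fin n → ℝ) (p : Fin n → ℝ) : Fin n → ℝ := fun i =>
  p i * (lamMean lam p - lam i) ^ 2 / ∑ j, p j * (lamMean lam p - lam j) ^ 2

/-- Membership in `dom(T) = Δₙ ∖ {e₁,…,eₙ}`: a probability vector that is not a vertex
of the simplex. -/
def memDomT {n : ℕ} (p : Fin n → ℝ) : Prop :=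
  p ∈ stdSimplex ℝ (Fin n) ∧ ∀ i : Fin n, p ≠ Pi.single i 1

/-- Akaike's coordinates `σ(y)ᵢ = λᵢ² yᵢ² / ∑ⱼ λⱼ² yⱼ²`. -/
def sigmaMap {n : ℕ} (lam : Fin n → ℝ) (y : Fin n → ℝ) : Fin n → ℝ := fun i =>
  lam i ^ 2 * y i ^ 2 / ∑ j, lam j ^ 2 * y j ^ 2

/-- The Kantorovich ratio `(∑ᵢ pᵢ / λᵢ) (∑ᵢ λᵢ pᵢ)`. -/
def kantorovichRatio {n : ℕ} (lam p : Fin n → ℝ) : ℝ :=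
  (∑ i, (lam i)⁻¹ * p i) * lamMean lam p

/-- The probability vector `[1 - s, 0, …, 0, s]`. -/
def endpointVec (n : ℕ) (s : ℝ) : Fin n → ℝ := fun i =>
  if (i : ℕ) = 0 then 1 - s else if (i : ℕ) = n - 1 then s else 0

section GeometricMean

lemma tendsto_geom_mean_of_pos {u : ℕ → ℝ} {L : ℝ} (hu : ∀ j, 0 < u j) (hL : 0 < L)
    (h : Tendsto u atTop (nhds L)) :
    Tendsto (fun k : ℕ => (∏ j ∈ Finset.range k, u j) ^ ((k : ℝ)⁻¹)) atTop (nhds L) := by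
  have h1 := ((h.log hL.ne').cesaro).rexp
  rw [Real.exp_log hL] at h1
  refine h1.congr fun k => ?_
  rw [Real.rpow_def_of_pos (Finset.prod_pos fun j _ => hu j),
    Real.log_prod fun j _ => (hu j).ne', mul_comm]

lemma geom_mean_le_arith_mean_range {u : ℕ → ℝ} (hu : ∀ j, 0 ≤ u j) {k : ℕ} (hk : 0 < k) :
    (∏ j ∈ Finset.range k, u j) ^ ((k : ℝ)⁻¹) ≤ (k : ℝ)⁻¹ * ∑ j ∈ Finset.range k, u j := by
  have h := Real.geom_mean_le_arith_mean (Finset.range k) (fun _ => (1 : ℝ)) u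
    (fun _ _ => zero_le_one) (by simpa using hk) fun j _ => hu j
  simpa [div_eq_inv_mul] using h

lemma prod_range_le_prod_range_sqrt_even {u : ℕ → ℝ} (hu : ∀ j, 0 ≤ u j) (hu1 : ∀ j, u j ≤ 1)
    (k : ℕ) :
    ∏ j ∈ Finset.range k, u j ≤ ∏ j ∈ Finset.range k, √(u (2 * (j / 2))) := by
  have hev : ∀ m : ℕ,
      ∏ j ∈ Finset.range (2 * m), u j ≤ ∏ j ∈ Finset.range (2 * m), √(u (2 * (j / 2))) := by
    intro m
    induction m with
    | zero => simp
    | succ m ih =>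
      rw [show 2 * (m + 1) = 2 * m + 1 + 1 by ring]
      simp only [Finset.prod_range_succ, mul_assoc]
      rw [show 2 * m / 2 = m by omega, show (2 * m + 1) / 2 = m by omega,
        Real.mul_self_sqrt (hu _)]
      exact mul_le_mul ih (mul_le_of_le_one_right (hu _) (hu1 _))
        (mul_nonneg (hu _) (hu _)) (Finset.prod_nonneg fun _ _ => Real.sqrt_nonneg _)
  obtain ⟨m, rfl | rfl⟩ := Nat.even_or_odd' k
  · exact hev m
  · rw [Finset.prod_range_succ, Finset.prod_range_succ, show 2 * m / 2 = m by omega]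
    exact mul_le_mul (hev m) (Real.le_sqrt_of_sq_le (by nlinarith [hu (2 * m), hu1 (2 * m)]))
      (hu _) (Finset.prod_nonneg fun _ _ => Real.sqrt_nonneg _)

lemma tendsto_geom_mean_zero_of_even {u : ℕ → ℝ} (hu : ∀ j, 0 ≤ u j) (hu1 : ∀ j, u j ≤ 1)
    (h : Tendsto (fun k => u (2 * k)) atTop (nhds 0)) :
    Tendsto (fun k : ℕ => (∏ j ∈ Finset.range k, u j) ^ ((k : ℝ)⁻¹)) atTop (nhds 0) := by
  have hdiv : Tendsto (fun j : ℕ => j / 2) atTop atTop :=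
    Nat.tendsto_div_const_atTop two_ne_zero
  have h1 : Tendsto (fun j => √(u (2 * (j / 2)))) atTop (nhds 0) := by
    simpa using (h.comp hdiv).sqrt
  refine tendsto_of_tendsto_of_tendsto_of_le_of_le' tendsto_const_nhds h1.cesaro
    (Eventually.of_forall fun k => Real.rpow_nonneg (Finset.prod_nonneg fun j _ => hu j) _) ?_
  filter_upwards [eventually_gt_atTop 0] with k hk
  exact (Real.rpow_le_rpow (Finset.prod_nonneg fun j _ => hu j)
    (prod_range_le_prod_range_sqrt_even hu hu1 k) (by positivity)).trans
    (geom_mean_le_arith_mean_range (fun j => Real.sqrt_nonneg _) hk)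

lemma tendsto_of_tendsto_even_odd {u : ℕ → ℝ} {L : ℝ}
    (he : Tendsto (fun k => u (2 * k)) atTop (nhds L))
    (ho : Tendsto (fun k => u (2 * k + 1)) atTop (nhds L)) : Tendsto u atTop (nhds L) := by
  rw [Metric.tendsto_atTop] at *
  intro ε hε
  obtain ⟨N, hN⟩ := he ε hε
  obtain ⟨M, hM⟩ := ho ε hε
  refine ⟨2 * N + 2 * M + 1, fun k hk => ?_⟩
  obtain ⟨m, rfl | rfl⟩ := Nat.even_or_odd' k
  · exact hN m (by omega)
  · exact hM m (by omega)

end GeometricMean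

section GradientDescent

variable {n : ℕ} {lam : Fin n → ℝ}

lemma qform_pos (hlam : ∀ i, 0 < lam i) (k : ℕ) {x : Fin n → ℝ} (hx : x ≠ 0) :
    0 < qform lam k x := by
  obtain ⟨i, hi⟩ := Function.ne_iff.mp hx
  have hi' : x i ≠ 0 := hi
  refine Finset.sum_pos' (fun j _ => mul_nonneg (pow_pos (hlam j) k).le (sq_nonneg _))
    ⟨i, Finset.mem_univ i, mul_pos (pow_pos (hlam i) k) (by positivity)⟩

lemma GD_zero : GD lam 0 = 0 := if_pos rfl

lemma GD_apply {x : Fin n → ℝ} (hx : x ≠ 0) (i : Fin n) :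
    GD lam x i = x i - qform lam 2 x / qform lam 3 x * (lam i * x i) := by
  rw [GD, if_neg hx]

lemma GD_ne_zero_of_not_eigenvector (hlam : ∀ i, 0 < lam i) {x : Fin n → ℝ} (hx : x ≠ 0)
    (heig : ¬ ∃ μ : ℝ, (fun i => lam i * x i) = fun i => μ * x i) : GD lam x ≠ 0 := by
  intro h
  refine heig ⟨(qform lam 2 x / qform lam 3 x)⁻¹, funext fun i => ?_⟩
  have hα := (div_pos (qform_pos hlam 2 hx) (qform_pos hlam 3 hx)).ne'
  have hi := congrFun h i
  rw [GD_apply hx, Pi.zero_apply, sub_eq_zero] at hi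
  conv_rhs => rw [hi]
  rw [inv_mul_cancel_left₀ hα]

lemma GD_GD_ne_zero (hlam : ∀ i, 0 < lam i) {x : Fin n → ℝ} (h : GD lam x ≠ 0) :
    GD lam (GD lam x) ≠ 0 := by
  have hx : x ≠ 0 := fun h0 => h (by rw [h0, GD_zero])
  intro hB
  set α := qform lam 2 x / qform lam 3 x with hα
  set β := qform lam 2 (GD lam x) / qform lam 3 (GD lam x) with hβ
  have horth : ∑ i, lam i ^ 2 * x i * GD lam x i = 0 := by
    have : ∑ i, lam i ^ 2 * x i * GD lam x i = qform lam 2 x - α * qform lam 3 x := by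
      simp only [qform, Finset.mul_sum, ← Finset.sum_sub_distrib]
      refine Finset.sum_congr rfl fun i _ => ?_
      rw [GD_apply hx, ← hα]
      ring
    rw [this, hα, div_mul_cancel₀ _ (qform_pos hlam 3 hx).ne', sub_self]
  have hzero : qform lam 1 (GD lam x) = 0 := by
    have : qform lam 1 (GD lam x) = (β - α) * ∑ i, lam i ^ 2 * x i * GD lam x i := by
      simp only [qform, Finset.mul_sum]
      refine Finset.sum_congr rfl fun i _ => ?_
      have hi := congrFun hB i
      rw [GD_apply h, Pi.zero_apply, ← hβ] at hi
      have hi' := GD_apply (lam := lam) hx i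
      rw [← hα] at hi'
      linear_combination lam i * GD lam x i * hi' + lam i * x i * hi
    rw [this, horth, mul_zero]
  exact (qform_pos hlam 1 h).ne' hzero

lemma GD_iterate_ne_zero (hlam : ∀ i, 0 < lam i) {x : Fin n → ℝ} (h : GD lam x ≠ 0) (j : ℕ) :
    GD lam ((GD lam)^[j] x) ≠ 0 := by
  induction j with
  | zero => exact h
  | succ j ih =>
    rw [Function.iterate_succ_apply']
    exact GD_GD_ne_zero hlam ih

lemma iterate_ne_zero (hlam : ∀ i, 0 < lam i) {x : Fin n → ℝ} (h : GD lam x ≠ 0) (j : ℕ) :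
    (GD lam)^[j] x ≠ 0 :=
  fun h0 => GD_iterate_ne_zero hlam h j (by rw [h0, GD_zero])

lemma shrink_nonneg (x : Fin n → ℝ) : 0 ≤ shrink lam x := by
  unfold shrink
  split_ifs
  exacts [le_rfl, Real.sqrt_nonneg _]

lemma shrink_le_one (hlam : ∀ i, 0 < lam i) (x : Fin n → ℝ) : shrink lam x ≤ 1 := by
  unfold shrink
  split_ifs with hx
  · exact zero_le_one
  · have h1 := qform_pos hlam 1 hx
    have h3 := qform_pos hlam 3 hx
    rw [Real.sqrt_le_one, sub_le_self_iff]
    positivity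

lemma qform_one_GD (hlam : ∀ i, 0 < lam i) {x : Fin n → ℝ} (hx : x ≠ 0) :
    qform lam 1 (GD lam x) =
      qform lam 1 x * (1 - qform lam 2 x ^ 2 / (qform lam 1 x * qform lam 3 x)) := by
  have h1 := (qform_pos hlam 1 hx).ne'
  have h3 := (qform_pos hlam 3 hx).ne'
  set α := qform lam 2 x / qform lam 3 x with hα
  have : qform lam 1 (GD lam x) =
      qform lam 1 x - 2 * α * qform lam 2 x + α ^ 2 * qform lam 3 x := by
    simp only [qform, Finset.mul_sum, ← Finset.sum_sub_distrib, ← Finset.sum_add_distrib]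
    refine Finset.sum_congr rfl fun i _ => ?_
    rw [GD_apply hx, ← hα]
    ring
  rw [this, hα]
  field_simp
  ring

lemma shrink_pos (hlam : ∀ i, 0 < lam i) {x : Fin n → ℝ} (h : GD lam x ≠ 0) :
    0 < shrink lam x := by
  have hx : x ≠ 0 := fun h0 => h (by rw [h0, GD_zero])
  rw [shrink, if_neg hx]
  have h1 := qform_pos hlam 1 h
  rw [qform_one_GD hlam hx] at h1
  exact Real.sqrt_pos.mpr (pos_of_mul_pos_right h1 (qform_pos hlam 1 hx).le)

lemma sigmaMap_apply (x : Fin n → ℝ) (i : Fin n) :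
    sigmaMap lam x i = lam i ^ 2 * x i ^ 2 / qform lam 2 x := rfl

lemma lamMean_sigmaMap (x : Fin n → ℝ) :
    lamMean lam (sigmaMap lam x) = qform lam 3 x / qform lam 2 x := by
  rw [lamMean, qform, Finset.sum_div]
  refine Finset.sum_congr rfl fun i _ => ?_
  rw [sigmaMap_apply]
  ring

lemma sum_inv_mul_sigmaMap (hlam : ∀ i, 0 < lam i) (x : Fin n → ℝ) :
    ∑ i, (lam i)⁻¹ * sigmaMap lam x i = qform lam 1 x / qform lam 2 x := by
  conv_rhs => rw [qform, Finset.sum_div]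
  refine Finset.sum_congr rfl fun i _ => ?_
  rw [sigmaMap_apply]
  have := (hlam i).ne'
  field_simp

lemma shrink_eq_sqrt_kantorovichRatio (hlam : ∀ i, 0 < lam i) {x : Fin n → ℝ} (hx : x ≠ 0) :
    shrink lam x = √(1 - (kantorovichRatio lam (sigmaMap lam x))⁻¹) := by
  have h1 := (qform_pos hlam 1 hx).ne'
  have h2 := (qform_pos hlam 2 hx).ne'
  have h3 := (qform_pos hlam 3 hx).ne'
  rw [shrink, if_neg hx, kantorovichRatio, lamMean_sigmaMap, sum_inv_mul_sigmaMap hlam]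
  congr 2
  field_simp

lemma sigmaMap_GD (hlam : ∀ i, 0 < lam i) {x : Fin n → ℝ} (hx : x ≠ 0) :
    sigmaMap lam (GD lam x) = Tmap lam (sigmaMap lam x) := by
  have h2 := (qform_pos hlam 2 hx).ne'
  have h3 := (qform_pos hlam 3 hx).ne'
  have hterm : ∀ i, lam i ^ 2 * GD lam x i ^ 2 = qform lam 2 x ^ 3 / qform lam 3 x ^ 2 *
      (sigmaMap lam x i * (lamMean lam (sigmaMap lam x) - lam i) ^ 2) := by
    intro i
    rw [GD_apply hx, lamMean_sigmaMap, sigmaMap_apply]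
    field_simp
  funext i
  rw [sigmaMap_apply, qform, Tmap, hterm, Finset.sum_congr rfl fun j _ => hterm j,
    ← Finset.mul_sum, mul_div_mul_left]
  exact div_ne_zero (pow_ne_zero _ h2) (pow_ne_zero _ h3)

lemma sigmaMap_iterate_GD (hlam : ∀ i, 0 < lam i) {x : Fin n → ℝ} (h : GD lam x ≠ 0) (j : ℕ) :
    sigmaMap lam ((GD lam)^[j] x) = (Tmap lam)^[j] (sigmaMap lam x) := by
  induction j with
  | zero => rfl
  | succ j ih =>
    rw [Function.iterate_succ_apply', Function.iterate_succ_apply',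
      sigmaMap_GD hlam (iterate_ne_zero hlam h j), ih]

lemma continuous_lamMean : Continuous (lamMean lam) := by
  unfold lamMean
  fun_prop

lemma continuous_kantorovichRatio : Continuous (kantorovichRatio lam) := by
  unfold kantorovichRatio lamMean
  fun_prop

lemma continuousAt_Tmap {p : Fin n → ℝ}
    (hp : ∑ j, p j * (lamMean lam p - lam j) ^ 2 ≠ 0) : ContinuousAt (Tmap lam) p := by
  have hc := continuous_lamMean (lam := lam)
  refine continuousAt_pi.mpr fun i => ?_
  refine ContinuousAt.div ?_ ?_ hp
  · exact Continuous.continuousAt (by fun_prop)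
  · exact Continuous.continuousAt (by fun_prop)

end GradientDescent

section Endpoints

variable {n : ℕ} {lam : Fin n → ℝ} {i₀ i₁ : Fin n}

lemma sum_mul_endpointVec (hn : 2 ≤ n) (h₀ : (i₀ : ℕ) = 0) (h₁ : (i₁ : ℕ) = n - 1)
    (f : Fin n → ℝ) (s : ℝ) :
    ∑ i, f i * endpointVec n s i = f i₀ * (1 - s) + f i₁ * s := by
  have : ∀ i, f i * endpointVec n s i =
      (if i = i₀ then f i * (1 - s) else 0) + (if i = i₁ then f i * s else 0) := by
    intro i
    simp only [endpointVec, Fin.ext_iff, h₀, h₁]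
    split_ifs <;> first | omega | simp
  simp [this, Finset.sum_add_distrib]

lemma lamMean_endpointVec (hn : 2 ≤ n) (h₀ : (i₀ : ℕ) = 0) (h₁ : (i₁ : ℕ) = n - 1) (s : ℝ) :
    lamMean lam (endpointVec n s) = lam i₀ * (1 - s) + lam i₁ * s :=
  sum_mul_endpointVec hn h₀ h₁ lam s

lemma kantorovichRatio_endpointVec (hn : 2 ≤ n) (h₀ : (i₀ : ℕ) = 0) (h₁ : (i₁ : ℕ) = n - 1)
    (hl₀ : lam i₀ ≠ 0) (hl₁ : lam i₁ ≠ 0) (s : ℝ) :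
    kantorovichRatio lam (endpointVec n s) =
      1 + s * (1 - s) * ((lam i₀ - lam i₁) ^ 2 / (lam i₀ * lam i₁)) := by
  rw [kantorovichRatio, lamMean_endpointVec hn h₀ h₁, sum_mul_endpointVec hn h₀ h₁]
  field_simp
  ring

lemma variance_endpointVec (hn : 2 ≤ n) (h₀ : (i₀ : ℕ) = 0) (h₁ : (i₁ : ℕ) = n - 1) (s : ℝ) :
    ∑ j, endpointVec n s j * (lamMean lam (endpointVec n s) - lam j) ^ 2 =
      s * (1 - s) * (lam i₀ - lam i₁) ^ 2 := by
  simp only [mul_comm (endpointVec n s _)]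
  rw [sum_mul_endpointVec hn h₀ h₁, lamMean_endpointVec hn h₀ h₁]
  ring

lemma Tmap_endpointVec (hn : 2 ≤ n) (h₀ : (i₀ : ℕ) = 0) (h₁ : (i₁ : ℕ) = n - 1)
    (hl : lam i₀ - lam i₁ ≠ 0) {s : ℝ} (hs : s ≠ 0) (hs' : 1 - s ≠ 0) :
    Tmap lam (endpointVec n s) = endpointVec n (1 - s) := by
  funext i
  rw [Tmap, variance_endpointVec hn h₀ h₁, lamMean_endpointVec hn h₀ h₁,
    div_eq_iff (by positivity)]
  rcases eq_or_ne i i₀ with rfl | hi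
  · simp only [endpointVec, if_pos h₀]
    ring
  rcases eq_or_ne i i₁ with rfl | hi'
  · simp only [endpointVec, if_pos h₁, if_neg (show ¬ (i : ℕ) = 0 by omega)]
    ring
  · have e₀ : ¬ (i : ℕ) = 0 := fun h => hi (Fin.ext (h.trans h₀.symm))
    have e₁ : ¬ (i : ℕ) = n - 1 := fun h => hi' (Fin.ext (h.trans h₁.symm))
    simp [endpointVec, e₀, e₁]

end Endpoints

/-- if the even iterates of `T` started at `p⁰ = σ(x⁰)` converge to
`[1−s,0,…,0,s]`, then `ρ*(x⁰,λ) = √(1 − (1−s+sa)⁻¹(1−s+s/a)⁻¹)`, `a = λₙ/λ₁`. -/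
theorem rocGD_of_limit_probability (n : ℕ) (hn : 2 ≤ n) (lam : Fin n → ℝ)
    (hord : ∀ i j : Fin n, i < j → lam j < lam i)
    (hpos : 0 < lam ⟨n - 1, by omega⟩)
    (a : ℝ) (ha : a = lam ⟨n - 1, by omega⟩ / lam ⟨0, by omega⟩)
    (x0 : Fin n → ℝ) (hx0 : x0 ≠ 0)
    (heig : ¬ ∃ μ : ℝ, (fun i => lam i * x0 i) = fun i => μ * x0 i)
    (p0 : Fin n → ℝ) (hp0 : p0 = sigmaMap lam x0)
    (s : ℝ) (hs : s ∈ Set.Icc (0 : ℝ) 1)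
    (hlim : Filter.Tendsto (fun k : ℕ => (Tmap lam)^[2 * k] p0) Filter.atTop
      (nhds (fun i : Fin n =>
        if (i : ℕ) = 0 then 1 - s else if (i : ℕ) = n - 1 then s else 0))) :
    rocGD lam x0 = Real.sqrt (1 - (1 - s + s * a)⁻¹ * (1 - s + s / a)⁻¹) := by
  set i₀ : Fin n := ⟨0, by omega⟩ with hi₀
  set i₁ : Fin n := ⟨n - 1, by omega⟩ with hi₁
  have h₀ : (i₀ : ℕ) = 0 := rfl
  have h₁ : (i₁ : ℕ) = n - 1 := rfl
  have hlam : ∀ i, 0 < lam i := by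
    intro i
    rcases eq_or_ne i i₁ with rfl | hi
    · exact hpos
    · refine hpos.trans (hord i i₁ (lt_of_le_of_ne ?_ hi))
      rw [Fin.le_def]
      omega
  have hlt : lam i₁ < lam i₀ := hord _ _ (by rw [Fin.lt_def]; omega)
  have hd : lam i₀ - lam i₁ ≠ 0 := (sub_pos.mpr hlt).ne'
  have hl₀ := hlam i₀
  have hl₁ := hlam i₁
  set c := (lam i₀ - lam i₁) ^ 2 / (lam i₀ * lam i₁) with hc
  have hcpos : 0 < c := by positivity
  have hratio : ∀ t, kantorovichRatio lam (endpointVec n t) = 1 + t * (1 - t) * c :=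
    kantorovichRatio_endpointVec hn h₀ h₁ hl₀.ne' hl₁.ne'
  have hK : (1 - s + s * a)⁻¹ * (1 - s + s / a)⁻¹ = (1 + s * (1 - s) * c)⁻¹ := by
    rw [← mul_inv, ha, hc]
    congr 1
    field_simp
    ring
  have hone : 1 ≤ 1 + s * (1 - s) * c := by
    have : 0 ≤ s * (1 - s) := mul_nonneg hs.1 (sub_nonneg.mpr hs.2)
    exact le_add_of_nonneg_right (mul_nonneg this hcpos.le)
  have hG := GD_ne_zero_of_not_eigenvector hlam hx0 heig
  have hu : ∀ j, shrink lam ((GD lam)^[j] x0) =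
      √(1 - (kantorovichRatio lam ((Tmap lam)^[j] p0))⁻¹) := by
    intro j
    rw [shrink_eq_sqrt_kantorovichRatio hlam (iterate_ne_zero hlam hG j),
      sigmaMap_iterate_GD hlam hG, hp0]
  have hcont : ∀ {t : ℝ} {q : ℕ → Fin n → ℝ}, t * (1 - t) = s * (1 - s) →
      Tendsto q atTop (nhds (endpointVec n t)) →
      Tendsto (fun k => √(1 - (kantorovichRatio lam (q k))⁻¹)) atTop
        (nhds √(1 - (1 + s * (1 - s) * c)⁻¹)) := by
    intro t q ht hq
    have h := (continuous_kantorovichRatio (lam := lam)).continuousAt.tendsto.comp hq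
    rw [hratio, ht] at h
    exact ((h.inv₀ (by positivity)).const_sub 1).sqrt
  have heven : Tendsto (fun k => shrink lam ((GD lam)^[2 * k] x0)) atTop
      (nhds √(1 - (1 + s * (1 - s) * c)⁻¹)) := by
    simp only [hu]
    exact hcont rfl hlim
  rw [hK]
  refine Tendsto.limsup_eq ?_
  rcases eq_or_ne (s * (1 - s)) 0 with hs0 | hs0
  · have hL : √(1 - (1 + s * (1 - s) * c)⁻¹) = 0 := by simp [hs0]
    rw [hL] at heven ⊢
    exact tendsto_geom_mean_zero_of_even (u := fun j => shrink lam ((GD lam)^[j] x0))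
      (fun j => shrink_nonneg _) (fun j => shrink_le_one hlam _) heven
  · have hs1 : s ≠ 0 := left_ne_zero_of_mul hs0
    have hs2 : 1 - s ≠ 0 := right_ne_zero_of_mul hs0
    have hvar : ∑ j, endpointVec n s j * (lamMean lam (endpointVec n s) - lam j) ^ 2 ≠ 0 := by
      rw [variance_endpointVec hn h₀ h₁]
      positivity
    have hodd : Tendsto (fun k => shrink lam ((GD lam)^[2 * k + 1] x0)) atTop
        (nhds √(1 - (1 + s * (1 - s) * c)⁻¹)) := by
      simp only [hu]
      simp only [Function.iterate_succ_apply']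
      refine hcont (t := 1 - s) (by ring) ?_
      rw [← Tmap_endpointVec hn h₀ h₁ hd hs1 hs2]
      exact (continuousAt_Tmap hvar).tendsto.comp hlim
    have hspos : 0 < s * (1 - s) :=
      lt_of_le_of_ne (mul_nonneg hs.1 (sub_nonneg.mpr hs.2)) hs0.symm
    have hLpos : 0 < √(1 - (1 + s * (1 - s) * c)⁻¹) :=
      Real.sqrt_pos.mpr (sub_pos.mpr (inv_lt_one_of_one_lt₀ 
        (lt_add_of_pos_right 1 (mul_pos hspos hcpos))))
    exact tendsto_geom_mean_of_pos (u := fun j => shrink lam ((GD lam)^[j] x0))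
      (fun j => shrink_pos hlam (GD_iterate_ne_zero hlam hG j)) hLpos
      (tendsto_of_tendsto_even_odd heven hodd)

end
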